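/- Under the stated normalization, the tangent vector field V satisfies V(0) = 0, V(1) = 0, and V(z)/z² → 0 as |z| → ∞ (i.e. |V(z)| = o(|z|²) as z → ∞). -/

import Mathlib

/-- `h` is a holomorphic motion of `E ⊆ ℂ` parametrized by the disk `Δ_r = {|c| < r}`
with base point `0`: `h 0 z = z` on `E`; `z ↦ h c z` is injective on `E` for each
`c ∈ Δ_r`; and `c ↦ h c z` is holomorphic on `Δ_r` for each `z ∈ E`. -/
def IsHolomorphicMotion (r : ℝ) (E : Set ℂ) (h : ℂ → ℂ → ℂ) : Prop :=
  (∀ z ∈ E, h 0 z = z) ∧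
  (∀ c ∈ Metric.ball (0 : ℂ) r, Set.InjOn (fun z => h c z) E) ∧
  (∀ z ∈ E, DifferentiableOn ℂ (fun c => h c z) (Metric.ball (0 : ℂ) r))

section Landau

open Metric Set Complex

/-- A nonvanishing holomorphic function on a disk has a holomorphic logarithm with prescribed
value at the centre. -/
theorem exists_log_on_ball {f : ℂ → ℂ} {c a : ℂ} {r : ℝ} (hr : 0 < r)
    (hf : DifferentiableOn ℂ f (ball c r)) (hf0 : ∀ z ∈ ball c r, f z ≠ 0) (ha : exp a = f c) :
    ∃ L : ℂ → ℂ, DifferentiableOn ℂ L (ball c r) ∧ L c = a ∧ ∀ z ∈ ball c r, exp (L z) = f z := by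
  have hc : c ∈ ball c r := mem_ball_self hr
  obtain ⟨P, hP⟩ := ((hf.deriv isOpen_ball).div hf hf0).isExactOn_ball
  have hL : ∀ z ∈ ball c r, HasDerivAt (fun w => P w + (a - P c)) (deriv f z / f z) z :=
    fun z hz => (hP z hz).add_const _
  have hq : ∀ z ∈ ball c r, HasDerivAt (fun w => f w * exp (-(P w + (a - P c)))) 0 z := by
    intro z hz
    have h1 := (hf.differentiableAt (isOpen_ball.mem_nhds hz)).hasDerivAt
    refine (h1.mul (hL z hz).neg.cexp).congr_deriv ?_
    have hfz := hf0 z hz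
    field_simp
    ring
  refine ⟨fun w => P w + (a - P c), fun z hz => (hL z hz).differentiableAt.differentiableWithinAt,
    by simp, fun z hz => ?_⟩
  have h2 := isOpen_ball.is_const_of_deriv_eq_zero (convex_ball c r).isPreconnected
    (fun z hz => (hq z hz).differentiableAt.differentiableWithinAt)
    (fun z hz => (hq z hz).deriv) hz hc
  have h3 : f z * exp (-(P z + (a - P c))) = 1 := by
    rw [h2, ← ha, ← exp_add]; simp
  rw [exp_neg] at h3
  field_simp at h3
  exact h3.symm

/-- If `‖g'‖` is at most `2‖g'(p)‖` on the ball of radius `t` about `p`, then the image of `g`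
contains a ball of radius comparable to `t‖g'(p)‖`. -/
theorem ball_subset_image_of_norm_deriv_le {g : ℂ → ℂ} {p : ℂ} {t : ℝ} (ht : 0 < t)
    (hg : DifferentiableOn ℂ g (ball p t)) (hp : deriv g p ≠ 0)
    (hbd : ∀ z ∈ ball p t, ‖deriv g z‖ ≤ 2 * ‖deriv g p‖) :
    ball (g p) (‖deriv g p‖ * t / 24) ⊆ g '' ball p t := by
  set A := ‖deriv g p‖ with hA
  have hA0 : 0 < A := norm_pos_iff.mpr hp
  have hpt : p ∈ ball p t := mem_ball_self ht
  have hsub : closedBall p (t / 6) ⊆ ball p t := closedBall_subset_ball (by linarith)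
  have hder : ∀ z ∈ ball p t, HasDerivAt g (deriv g z) z := fun z hz =>
    (hg.differentiableAt (isOpen_ball.mem_nhds hz)).hasDerivAt
  have hclose : ∀ z ∈ closedBall p (t / 6), ‖deriv g z - deriv g p‖ ≤ A / 2 := by
    intro z hz
    have hmaps : MapsTo (deriv g) (ball p t) (closedBall (deriv g p) (3 * A)) := by
      intro w hw
      rw [mem_closedBall, dist_eq_norm]
      calc _ ≤ ‖deriv g w‖ + ‖deriv g p‖ := norm_sub_le _ _
        _ ≤ 3 * A := by linarith [hbd w hw]
    have h1 := dist_le_div_mul_dist_of_mapsTo_ball (hg.deriv isOpen_ball) hmaps (hsub hz)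
    rw [dist_eq_norm] at h1
    calc _ ≤ 3 * A / t * dist z p := h1
      _ ≤ 3 * A / t * (t / 6) := by gcongr; exact hz
      _ = A / 2 := by field_simp; norm_num
  have hlow : ∀ z ∈ sphere p (t / 6), A * t / 12 ≤ ‖g z - g p‖ := by
    intro z hz
    have hmvt := (convex_closedBall p (t / 6)).norm_image_sub_le_of_norm_hasDerivWithin_le
      (f := fun w => g w - deriv g p * w) (f' := fun w => deriv g w - deriv g p * 1)
      (fun w hw => ((hder w (hsub hw)).sub ((hasDerivAt_id w).const_mul _)).hasDerivWithinAt)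
      (fun w hw => by simpa using hclose w hw)
      (mem_closedBall_self (by positivity)) (sphere_subset_closedBall hz)
    have hz' : ‖z - p‖ = t / 6 := by simpa [dist_eq_norm] using hz
    have h2 : ‖deriv g p * (z - p)‖ = A * (t / 6) := by rw [norm_mul, hz']
    have h3 : ‖deriv g p * (z - p)‖ ≤ ‖g z - g p‖ +
        ‖(g z - deriv g p * z) - (g p - deriv g p * p)‖ := by
      have : deriv g p * (z - p) = (g z - g p) -
        ((g z - deriv g p * z) - (g p - deriv g p * p)) := by ring
      rw [this]; exact norm_sub_le _ _
    rw [hz'] at hmvt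
    linarith
  have hfreq : ∃ᶠ z in nhds p, g z ≠ g p :=
    ((hder p hpt).eventually_ne hp).frequently.filter_mono nhdsWithin_le_nhds
  have h4 := ((hg.mono hsub).diffContOnCl_ball subset_rfl).ball_subset_image_closedBall
    (by positivity : 0 < t / 6) hlow hfreq
  rw [show A * t / 24 = A * t / 12 / 2 by ring]
  exact h4.trans (image_mono hsub)

/-- A weak form of **Bloch's theorem**: if the image of the unit disk under `g` contains no ball
of radius `R`, then `‖g'(0)‖ ≤ 96 R`. -/
theorem norm_deriv_le_of_forall_ball_not_subset_image {g : ℂ → ℂ} {R : ℝ}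
    (hg : DifferentiableOn ℂ g (ball 0 1))
    (hR : ∀ w : ℂ, ¬ ball w R ⊆ g '' ball 0 1) : ‖deriv g 0‖ ≤ 96 * R := by
  have hsub : closedBall (0 : ℂ) (1 / 2) ⊆ ball 0 1 := closedBall_subset_ball (by norm_num)
  by_contra! hlt
  have hR0 : 0 < R := by
    by_contra! h
    exact hR 0 (by simp [ball_eq_empty.mpr h])
  have hcont : ContinuousOn (fun z => (1 / 2 - ‖z‖) * ‖deriv g z‖) (closedBall (0 : ℂ) (1 / 2)) :=
    (by fun_prop : Continuous fun z : ℂ => 1 / 2 - ‖z‖).continuousOn.mul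
      (((hg.deriv isOpen_ball).continuousOn.mono hsub).norm)
  obtain ⟨p, hp, hmax⟩ := (isCompact_closedBall (0 : ℂ) (1 / 2)).exists_isMaxOn
    ⟨0, by simp⟩ hcont
  have hmax' : ∀ z ∈ closedBall (0 : ℂ) (1 / 2),
    (1 / 2 - ‖z‖) * ‖deriv g z‖ ≤ (1 / 2 - ‖p‖) * ‖deriv g p‖ := hmax
  have h0 := hmax' 0 (by simp)
  rw [norm_zero, sub_zero] at h0
  have hp' : ‖p‖ ≤ 1 / 2 := by simpa using hp
  have hM : 48 * R < (1 / 2 - ‖p‖) * ‖deriv g p‖ := by linarith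
  have hs : 0 < 1 / 2 - ‖p‖ := by
    rcases hp'.lt_or_eq with h | h
    · linarith
    · rw [h] at hM; linarith
  have hdp : 0 < ‖deriv g p‖ := by
    by_contra! h
    nlinarith [norm_nonneg (deriv g p)]
  set t := (1 / 2 - ‖p‖) / 2 with ht
  have ht0 : 0 < t := by positivity
  have hz : ∀ z ∈ ball p t, t ≤ 1 / 2 - ‖z‖ := by
    intro z hz
    have h1 : ‖z - p‖ < t := by simpa [dist_eq_norm] using hz
    have h2 : ‖z‖ ≤ ‖z - p‖ + ‖p‖ := by simpa using norm_add_le (z - p) p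
    linarith
  have hball : ball p t ⊆ closedBall (0 : ℂ) (1 / 2) := fun z hzt => by
    have := hz z hzt
    simp only [mem_closedBall, dist_zero_right]; linarith
  have hbig := ball_subset_image_of_norm_deriv_le ht0 (hg.mono (hball.trans hsub))
    (norm_pos_iff.mp hdp) (fun z hzt => by
      have h1 := hmax' z (hball hzt)
      have h2 : t * ‖deriv g z‖ ≤ (1 / 2 - ‖z‖) * ‖deriv g z‖ := by
        gcongr; exact hz z hzt
      have h3 : t * ‖deriv g z‖ ≤ t * (2 * ‖deriv g p‖) := by
        calc _ ≤ _ := h2.trans h1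
          _ = _ := by rw [ht]; ring
      exact le_of_mul_le_mul_left h3 ht0)
  refine hR (g p) (((ball_subset_ball ?_).trans hbig).trans (image_mono (hball.trans hsub)))
  rw [ht]
  linarith

/-- Every ball of radius `7` contains a point at which `cosh` takes an integer value. -/
theorem exists_mem_ball_cosh_eq_int (w : ℂ) : ∃ v ∈ ball w 7, ∃ n : ℤ, cosh v = n := by
  have hX : 0 ≤ |w.re| := abs_nonneg _
  have hgap : Real.cosh |w.re| + 1 ≤ Real.cosh (|w.re| + 3) := by
    have h1 : 0 ≤ Real.sinh |w.re| * Real.sinh 3 :=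
      mul_nonneg (Real.sinh_nonneg_iff.mpr hX) (Real.sinh_nonneg_iff.mpr (by norm_num))
    have h2 : 2 ≤ Real.cosh 3 := by
      rw [Real.cosh_eq]
      linarith [Real.add_one_le_exp (3 : ℝ), Real.exp_pos (-3)]
    rw [Real.cosh_add]
    nlinarith [Real.one_le_cosh |w.re|]
  obtain ⟨x, ⟨hx1, hx2⟩, hx⟩ := intermediate_value_Icc (by linarith : |w.re| ≤ |w.re| + 3)
    Real.continuous_cosh.continuousOn
    ⟨Int.le_ceil (Real.cosh |w.re|), (Int.ceil_lt_add_one _).le.trans hgap⟩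
  obtain ⟨y, hyc, hy⟩ : ∃ y : ℝ, Real.cosh y = Real.cosh x ∧ |y - w.re| ≤ 3 := by
    rcases le_total 0 w.re with h | h
    · rw [abs_of_nonneg h] at hx1 hx2
      exact ⟨x, rfl, abs_le.mpr ⟨by linarith, by linarith⟩⟩
    · rw [abs_of_nonpos h] at hx1 hx2
      exact ⟨-x, Real.cosh_neg x, abs_le.mpr ⟨by linarith, by linarith⟩⟩
  set k := round (w.im / (2 * Real.pi)) with hk
  have hpi := Real.pi_pos
  have him : |(k : ℝ) * (2 * Real.pi) - w.im| ≤ Real.pi := by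
    have h1 := abs_sub_round (w.im / (2 * Real.pi))
    rw [← hk, abs_sub_comm] at h1
    have h2 : (k : ℝ) * (2 * Real.pi) - w.im = (k - w.im / (2 * Real.pi)) * (2 * Real.pi) := by
      field_simp
    rw [h2, abs_mul, abs_of_pos (by positivity : 0 < 2 * Real.pi)]
    nlinarith
  refine ⟨(y : ℂ) + k * (2 * Real.pi * I), ?_, ⌈Real.cosh |w.re|⌉, ?_⟩
  · rw [mem_ball, dist_eq_norm]
    refine (norm_le_abs_re_add_abs_im _).trans_lt ?_
    have hre : ((y : ℂ) + k * (2 * Real.pi * I) - w).re = y - w.re := by simp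
    have him' : ((y : ℂ) + k * (2 * Real.pi * I) - w).im = k * (2 * Real.pi) - w.im := by simp
    rw [hre, him']
    linarith [Real.pi_lt_four]
  · rw [cosh_periodic.int_mul k, ← ofReal_cosh, hyc, hx]
    simp

/-- **Landau's theorem** for holomorphic functions on the unit disk omitting `0` and `1`. -/
theorem norm_deriv_le_of_ne_zero_of_ne_one {f : ℂ → ℂ} (hf : DifferentiableOn ℂ f (ball 0 1))
    (hf0 : ∀ z ∈ ball (0 : ℂ) 1, f z ≠ 0) (hf1 : ∀ z ∈ ball (0 : ℂ) 1, f z ≠ 1) :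
    ‖deriv f 0‖ ≤ 1344 * Real.pi * (‖f 0‖ * (‖log (f 0)‖ + 1)) := by
  have h0 : (0 : ℂ) ∈ ball (0 : ℂ) 1 := mem_ball_self one_pos
  have hpi : (Real.pi : ℂ) ≠ 0 := ofReal_ne_zero.mpr Real.pi_ne_zero
  obtain ⟨L, hLd, hL0, hL⟩ := exists_log_on_ball one_pos hf hf0 (exp_log (hf0 0 h0))
  set F : ℂ → ℂ := fun z => L z / (2 * Real.pi * I) with hF
  have hFd : DifferentiableOn ℂ F (ball 0 1) := hLd.div_const _
  have hFL : ∀ z, L z = F z * (2 * Real.pi * I) := fun z => by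
    rw [hF]; field_simp [I_ne_zero]
  have hFint : ∀ z ∈ ball (0 : ℂ) 1, ∀ n : ℤ, F z ≠ n := by
    intro z hz n hn
    apply hf1 z hz
    rw [← hL z hz, hFL, hn]
    exact exp_eq_one_iff.mpr ⟨n, rfl⟩
  have hsq0 : ∀ z ∈ ball (0 : ℂ) 1, F z ^ 2 - 1 ≠ 0 := by
    intro z hz h
    have h' : (F z - 1) * (F z + 1) = 0 := by linear_combination h
    rcases mul_eq_zero.mp h' with h' | h'
    · exact hFint z hz 1 (by push_cast; linear_combination h')
    · exact hFint z hz (-1) (by push_cast; linear_combination h')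
  obtain ⟨T, hTd, -, hT⟩ := exists_log_on_ball one_pos ((hFd.pow 2).sub_const 1) hsq0
    (exp_log (hsq0 0 h0))
  set S : ℂ → ℂ := fun z => exp (T z / 2) with hS
  have hSd : DifferentiableOn ℂ S (ball 0 1) := (hTd.div_const 2).cexp
  have hS2 : ∀ z ∈ ball (0 : ℂ) 1, S z ^ 2 = F z ^ 2 - 1 := fun z hz => by
    rw [show F z ^ 2 - 1 = exp (T z) from (hT z hz).symm, hS, ← exp_nat_mul]; congr 1; push_cast; ring
  have hprod : ∀ z ∈ ball (0 : ℂ) 1, (F z + S z) * (F z - S z) = 1 := fun z hz => by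
    linear_combination - hS2 z hz
  have hu0 : ∀ z ∈ ball (0 : ℂ) 1, F z + S z ≠ 0 := fun z hz =>
    left_ne_zero_of_mul_eq_one (hprod z hz)
  obtain ⟨G, hGd, -, hG⟩ := exists_log_on_ball one_pos (hFd.add hSd) hu0 (exp_log (hu0 0 h0))
  have hGneg : ∀ z ∈ ball (0 : ℂ) 1, exp (-G z) = F z - S z := fun z hz => by
    rw [exp_neg, hG z hz]; exact inv_eq_of_mul_eq_one_right (hprod z hz)
  have hcosh : ∀ z ∈ ball (0 : ℂ) 1, cosh (G z) = F z := fun z hz => by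
    rw [cosh, hGneg z hz, hG z hz]; simp
  have hsinh : sinh (G 0) = S 0 := by
    rw [sinh, hGneg 0 h0, hG 0 h0]; simp
  have hGb : ‖deriv G 0‖ ≤ 96 * 7 := by
    refine norm_deriv_le_of_forall_ball_not_subset_image hGd fun w hw => ?_
    obtain ⟨v, hv, n, hn⟩ := exists_mem_ball_cosh_eq_int w
    obtain ⟨z, hz, rfl⟩ := hw hv
    exact hFint z hz n (by rw [← hcosh z hz, hn])
  have hfder : deriv f 0 = f 0 * (S 0 * deriv G 0 * (2 * Real.pi * I)) := by
    have hGder := (hGd.differentiableAt (isOpen_ball.mem_nhds h0)).hasDerivAt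
    have h1 := (hGder.ccosh.mul_const (2 * Real.pi * I)).cexp
    have heq : f =ᶠ[nhds 0] fun z => exp (cosh (G z) * (2 * Real.pi * I)) := by
      filter_upwards [isOpen_ball.mem_nhds h0] with z hz
      rw [hcosh z hz, ← hFL, hL z hz]
    rw [heq.deriv_eq, h1.deriv, hcosh 0 h0, ← hFL, hL 0 h0, hsinh]
  have hF0 : ‖F 0‖ ≤ ‖log (f 0)‖ := by
    have h1 : ‖L 0‖ = ‖F 0‖ * (2 * Real.pi) := by
      rw [hFL]; simp [abs_of_pos Real.pi_pos]
    rw [← hL0, h1]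
    nlinarith [norm_nonneg (F 0), Real.pi_gt_three]
  have hS0 : ‖S 0‖ ≤ ‖F 0‖ + 1 := by
    have h1 : ‖S 0‖ ^ 2 ≤ ‖F 0‖ ^ 2 + 1 := by
      rw [← norm_pow, hS2 0 h0]
      exact (norm_sub_le _ _).trans_eq (by rw [norm_pow, norm_one])
    exact le_of_sq_le_sq (by nlinarith [norm_nonneg (F 0)]) (by positivity)
  calc ‖deriv f 0‖ = ‖f 0‖ * (‖S 0‖ * ‖deriv G 0‖ * (2 * Real.pi)) := by
        rw [hfder]; simp [abs_of_pos Real.pi_pos]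
    _ ≤ ‖f 0‖ * ((‖log (f 0)‖ + 1) * (96 * 7) * (2 * Real.pi)) := by
        have := Real.pi_pos
        gcongr
        linarith
    _ = _ := by ring

/-- `‖z‖ (‖log z‖ + 1)` is negligible compared with `‖z‖²` at infinity. -/
theorem tendsto_norm_log_add_one_div_norm :
    Filter.Tendsto (fun z : ℂ => (‖log z‖ + 1) / ‖z‖) (Bornology.cobounded ℂ) (nhds 0) := by
  have h1 : Filter.Tendsto (fun x : ℝ => Real.log x / x + (Real.pi + 1) / x) Filter.atTop
      (nhds 0) := by
    simpa using (Real.isLittleO_log_id_atTop.tendsto_div_nhds_zero).add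
      (Filter.tendsto_id.const_div_atTop (Real.pi + 1))
  refine squeeze_zero' (Filter.Eventually.of_forall fun z => by positivity) ?_
    (h1.comp (tendsto_norm_cobounded_atTop (E := ℂ)))
  filter_upwards [(tendsto_norm_cobounded_atTop (E := ℂ)).eventually_ge_atTop 1] with z hz
  have h2 : ‖log z‖ ≤ Real.log ‖z‖ + Real.pi := by
    refine (norm_le_abs_re_add_abs_im _).trans ?_
    rw [log_re, log_im, abs_of_nonneg (Real.log_nonneg hz)]
    gcongr
    exact abs_arg_le_pi z
  simp only [Function.comp]
  rw [← add_div]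
  refine div_le_div_of_nonneg_right ?_ (norm_nonneg z)
  linarith

end Landau

/-- Let `h` be a normalized holomorphic motion of `ℂ` parametrized by the
unit disk with base point `0` (fixing `0` and `1`, each time-`c` map a bijection of `ℂ`,
corresponding to a motion of the sphere fixing `∞`), and let
`V z = (d/dc) h(c,z) |_{c=0}` be the tangent vector field at the base point. Then
`V(0) = 0`, `V(1) = 0`, and `V(z)/z² → 0` as `z → ∞`. -/
theorem tangent_vector_normalization
    (h : ℂ → ℂ → ℂ) (hmot : IsHolomorphicMotion 1 Set.univ h)
    (hnorm0 : ∀ c ∈ Metric.ball (0 : ℂ) 1, h c 0 = 0)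
    (hnorm1 : ∀ c ∈ Metric.ball (0 : ℂ) 1, h c 1 = 1)
    (hbij : ∀ c ∈ Metric.ball (0 : ℂ) 1, Function.Bijective (fun z => h c z))
    (V : ℂ → ℂ) (hV : ∀ z : ℂ, V z = deriv (fun c => h c z) 0) :
    V 0 = 0 ∧ V 1 = 0 ∧
      Filter.Tendsto (fun z : ℂ => V z / z ^ 2) (Bornology.cobounded ℂ) (nhds 0) := by
  obtain ⟨hid, hinj, hdiff⟩ := hmot
  have hmem : (0 : ℂ) ∈ Metric.ball (0 : ℂ) 1 := Metric.mem_ball_self one_pos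
  have hnhds := Metric.isOpen_ball.mem_nhds hmem
  refine ⟨?_, ?_, ?_⟩
  · have heq : (fun c => h c 0) =ᶠ[nhds 0] fun _ => (0 : ℂ) :=
      Filter.eventually_of_mem hnhds hnorm0
    rw [hV, heq.deriv_eq, deriv_const]
  · have heq : (fun c => h c 1) =ᶠ[nhds 0] fun _ => (1 : ℂ) :=
      Filter.eventually_of_mem hnhds hnorm1
    rw [hV, heq.deriv_eq, deriv_const]
  · have hlim := tendsto_norm_log_add_one_div_norm.const_mul (1344 * Real.pi)
    rw [mul_zero] at hlim
    refine squeeze_zero_norm' ?_ hlim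
    filter_upwards [(tendsto_norm_cobounded_atTop (E := ℂ)).eventually_gt_atTop 1] with z hz
    have hz0 : z ≠ 0 := by rintro rfl; norm_num at hz
    have hz1 : z ≠ 1 := by rintro rfl; norm_num at hz
    have hbound := norm_deriv_le_of_ne_zero_of_ne_one (hdiff z (Set.mem_univ z))
      (fun c hc hzero => hz0 (hinj c hc (Set.mem_univ z) (Set.mem_univ 0)
        (hzero.trans (hnorm0 c hc).symm)))
      (fun c hc hone => hz1 (hinj c hc (Set.mem_univ z) (Set.mem_univ 1)
        (hone.trans (hnorm1 c hc).symm)))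
    rw [hid z (Set.mem_univ z), ← hV z] at hbound
    have hzpos : 0 < ‖z‖ := by linarith
    rw [norm_div, norm_pow, div_le_iff₀ (by positivity)]
    refine hbound.trans_eq ?_
    field_simp
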